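/- Let N ≥ 1, p > 0, and suppose N < 1 + (2/(p+1))(p + √(p(p+1))). Let ω₁, ω₂ : ℝ^N → ℝ be smooth positive functions such that: ω₂ is bounded on ℝ^N; and there is a constant C > 0 with ω₁(x) ≤ C ω₂(x) and |∇ω₁(x)| ≤ C ω₂(x) for all x with |x| sufficiently large. Then there is no positive stable super-solution of the equation −div(ω₁ ∇u) = −ω₂ u^{−p} in ℝ^N. -/

import Mathlib

open MeasureTheory Filter Real
open scoped RealInnerProductSpace

noncomputable def vdiv {N : ℕ} (V : EuclideanSpace ℝ (Fin N) → EuclideanSpace ℝ (Fin N))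
    (x : EuclideanSpace ℝ (Fin N)) : ℝ :=
  LinearMap.trace ℝ (EuclideanSpace ℝ (Fin N)) (fderiv ℝ V x).toLinearMap

def annulus (N : ℕ) (R : ℝ) : Set (EuclideanSpace ℝ (Fin N)) :=
  {x | R < ‖x‖ ∧ ‖x‖ < 2 * R}

section Gradient

variable {F : Type*} [NormedAddCommGroup F] [InnerProductSpace ℝ F] [CompleteSpace F]

theorem ContDiff.contDiff_gradient {f : F → ℝ} {m n : WithTop ℕ∞} (hf : ContDiff ℝ n f)
    (hmn : m + 1 ≤ n) : ContDiff ℝ m (gradient f) :=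
  (InnerProductSpace.toDual ℝ F).symm.contDiff.comp (hf.fderiv_right hmn)

theorem HasGradientAt.fun_mul {f g : F → ℝ} {f' g' x : F} (hf : HasGradientAt f f' x)
    (hg : HasGradientAt g g' x) :
    HasGradientAt (fun y => f y * g y) (f x • g' + g x • f') x := by
  rw [hasGradientAt_iff_hasFDerivAt] at *
  simpa using hf.fun_mul hg

theorem HasDerivAt.comp_hasGradientAt {h : ℝ → ℝ} {h' : ℝ} {f : F → ℝ} {f' : F} (x : F)
    (hh : HasDerivAt h h' (f x)) (hf : HasGradientAt f f' x) :
    HasGradientAt (fun y => h (f y)) (h' • f') x := by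
  rw [hasGradientAt_iff_hasFDerivAt] at *
  simpa [Function.comp_def] using hh.comp_hasFDerivAt x hf

theorem support_gradient_subset (f : F → ℝ) : Function.support (gradient f) ⊆ tsupport f := by
  intro x hx
  refine support_fderiv_subset ℝ fun h => hx ?_
  simp [gradient, h]

theorem HasCompactSupport.gradient {f : F → ℝ} (hf : HasCompactSupport f) :
    HasCompactSupport (gradient f) :=
  hf.mono' (support_gradient_subset f)

end Gradient

theorem vdiv_eq_sum {N : ℕ} (V : EuclideanSpace ℝ (Fin N) → EuclideanSpace ℝ (Fin N))
    (x : EuclideanSpace ℝ (Fin N)) :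
    vdiv V x = ∑ i, fderiv ℝ V x (EuclideanSpace.basisFun (Fin N) ℝ i) i := by
  rw [vdiv, LinearMap.trace_eq_sum_inner _ (EuclideanSpace.basisFun (Fin N) ℝ)]
  simp [EuclideanSpace.inner_single_left]

theorem continuous_vdiv {N : ℕ} {V : EuclideanSpace ℝ (Fin N) → EuclideanSpace ℝ (Fin N)}
    (hV : ContDiff ℝ 1 V) : Continuous (vdiv V) := by
  have h := hV.continuous_fderiv one_ne_zero
  simp only [funext (vdiv_eq_sum V)]
  fun_prop

theorem integral_mul_vdiv {N : ℕ} {V : EuclideanSpace ℝ (Fin N) → EuclideanSpace ℝ (Fin N)}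
    {g : EuclideanSpace ℝ (Fin N) → ℝ} (hV : ContDiff ℝ 1 V) (hg : ContDiff ℝ 1 g)
    (hgs : HasCompactSupport g) :
    ∫ x, g x * vdiv V x = -∫ x, ⟪V x, gradient g x⟫ := by
  set b := EuclideanSpace.basisFun (Fin N) ℝ
  have hV' := hV.continuous_fderiv one_ne_zero
  have hg' := hg.continuous_fderiv one_ne_zero
  have hVc := hV.continuous
  have hgc := hg.continuous
  have hVd (i : Fin N) (x) :
      HasFDerivAt (fun y => V y i) (PiLp.proj 2 (fun _ => ℝ) i ∘L fderiv ℝ V x) x :=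
    (PiLp.hasFDerivAt_apply (𝕜 := ℝ) 2 (V x) i).comp x (hV.differentiable one_ne_zero x).hasFDerivAt
  have hVi (i : Fin N) (x) : fderiv ℝ (fun y => V y i) x (b i) = fderiv ℝ V x (b i) i := by
    rw [(hVd i x).fderiv]
    rfl
  have hint₁ (i : Fin N) : Integrable fun x => g x * fderiv ℝ V x (b i) i :=
    Continuous.integrable_of_hasCompactSupport (by fun_prop) hgs.mul_right
  have hint₂ (i : Fin N) : Integrable fun x => fderiv ℝ g x (b i) * V x i :=
    Continuous.integrable_of_hasCompactSupport (by fun_prop)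
      (HasCompactSupport.mul_right (hgs.fderiv_apply ℝ _))
  have hinner (x) : ⟪V x, gradient g x⟫ = ∑ i, fderiv ℝ g x (b i) * V x i := by
    rw [← b.sum_inner_mul_inner]
    refine Finset.sum_congr rfl fun i _ => ?_
    rw [real_inner_comm (gradient g x), inner_gradient_left, mul_comm, real_inner_comm]
    simp [b, EuclideanSpace.inner_single_left]
  simp only [vdiv_eq_sum, Finset.mul_sum, hinner]
  rw [integral_finsetSum _ fun i _ => hint₁ i, integral_finsetSum _ fun i _ => hint₂ i,
    ← Finset.sum_neg_distrib]
  refine Finset.sum_congr rfl fun i _ => ?_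
  rw [← integral_mul_fderiv_eq_neg_fderiv_mul_of_integrable (hint₂ i)
    (by simpa only [hVi] using hint₁ i)
    (Continuous.integrable_of_hasCompactSupport (by fun_prop) hgs.mul_right)
    (fun x _ => hg.differentiable one_ne_zero x) (fun x _ => (hVd i x).differentiableAt)]
  simp only [b, hVi]

theorem exists_cutoff (N : ℕ) : ∃ K : ℝ, 0 ≤ K ∧ ∀ R : ℝ, 0 < R →
    ∃ η : EuclideanSpace ℝ (Fin N) → ℝ, ContDiff ℝ 2 η ∧ HasCompactSupport η ∧
      (∀ x, 0 ≤ η x) ∧ (∀ x, η x ≤ 1) ∧ (∀ x, ‖x‖ ≤ R → η x = 1) ∧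
      (∀ x, 2 * R ≤ ‖x‖ → η x = 0) ∧
      (∀ x, ‖gradient η x‖ ≤ K / R) ∧ (∀ x, ‖x‖ < R ∨ 2 * R < ‖x‖ → gradient η x = 0) := by
  let f : ContDiffBump (0 : EuclideanSpace ℝ (Fin N)) := ⟨1, 2, one_pos, one_lt_two⟩
  obtain ⟨K, hK⟩ := (f.hasCompactSupport.fderiv ℝ).exists_bound_of_continuous
    ((f.contDiff (n := 1)).continuous_fderiv one_ne_zero)
  refine ⟨K, (norm_nonneg _).trans (hK 0), fun R hR => ?_⟩
  have hder (x) : fderiv ℝ (fun y => f (R⁻¹ • y)) x = R⁻¹ • fderiv ℝ f (R⁻¹ • x) :=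
    fderiv_comp_smul _
  have hnorm (x : EuclideanSpace ℝ (Fin N)) : ‖R⁻¹ • x‖ = ‖x‖ / R := by
    rw [norm_smul, norm_inv, Real.norm_of_nonneg hR.le, div_eq_inv_mul]
  have hone (x) (hx : ‖x‖ ≤ R) : f (R⁻¹ • x) = 1 := f.one_of_mem_closedBall <| by
    simpa [hnorm, f] using div_le_one_of_le₀ hx hR.le
  have hzero (x) (hx : 2 * R ≤ ‖x‖) : f (R⁻¹ • x) = 0 := f.zero_of_le_dist <| by
    rw [dist_zero_right, hnorm]; exact (le_div_iff₀ hR).2 hx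
  refine ⟨fun x => f (R⁻¹ • x), f.contDiff.comp (contDiff_const_smul _),
    f.hasCompactSupport.comp_smul (inv_ne_zero hR.ne'), fun x => f.nonneg, fun x => f.le_one,
    hone, hzero, fun x => ?_, fun x hx => ?_⟩
  · rw [gradient, LinearIsometryEquiv.norm_map, hder, norm_smul, norm_inv,
      Real.norm_of_nonneg hR.le, div_eq_inv_mul]
    gcongr
    exact hK _
  · rcases hx with hx | hx
    · have : (fun y => f (R⁻¹ • y)) =ᶠ[nhds x] fun _ => 1 := by
        filter_upwards [(isOpen_lt continuous_norm continuous_const).mem_nhds hx] with y hy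
        exact hone y (le_of_lt hy)
      rw [this.gradient_eq, gradient_fun_const]
    · have : (fun y => f (R⁻¹ • y)) =ᶠ[nhds x] fun _ => 0 := by
        filter_upwards [(isOpen_lt continuous_const continuous_norm).mem_nhds hx] with y hy
        exact hzero y (le_of_lt hy)
      rw [this.gradient_eq, gradient_fun_const]

theorem stable_caccioppoli {N : ℕ} {p : ℝ} (hp : 0 < p)
    {ω₁ ω₂ u φ : EuclideanSpace ℝ (Fin N) → ℝ}
    (hω₁ : ContDiff ℝ 1 ω₁) (hω₂ : Continuous ω₂) (hω₁pos : ∀ x, 0 < ω₁ x)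
    (hu : ContDiff ℝ 2 u) (hupos : ∀ x, 0 < u x)
    (hsuper : ∀ x, -(ω₂ x * u x ^ (-p)) ≤ -vdiv (fun y => ω₁ y • gradient u y) x)
    (hstable : ∀ ψ : EuclideanSpace ℝ (Fin N) → ℝ, ContDiff ℝ 2 ψ → HasCompactSupport ψ →
      ∫ x, p * ω₂ x * u x ^ (-p - 1) * ψ x ^ 2 ≤ ∫ x, ω₁ x * ‖gradient ψ x‖ ^ 2)
    (hφ : ContDiff ℝ 2 φ) (hφs : HasCompactSupport φ) :
    p * ∫ x, ω₂ x * u x ^ (-3 * p - 1) * φ x ^ 2 ≤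
      (2 + p) * ∫ x, ω₁ x * u x ^ (-2 * p) * ‖gradient φ x‖ ^ 2 := by
  have hune (x) : u x ≠ 0 := (hupos x).ne'
  have hpow (s : ℝ) : ContDiff ℝ 2 fun x => u x ^ s := hu.rpow_const_of_ne hune
  have hpowc (s : ℝ) : Continuous fun x => u x ^ s := (hpow s).continuous
  have hgu : ContDiff ℝ 1 (gradient u) := hu.contDiff_gradient (by norm_num)
  have hV : ContDiff ℝ 1 fun y => ω₁ y • gradient u y := hω₁.smul hgu
  have hguc := hgu.continuous
  have hgφc := (hφ.contDiff_gradient (m := 1) (by norm_num)).continuous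
  have hω₁c := hω₁.continuous
  have hφc := hφ.continuous
  have hφ2s : HasCompactSupport fun x => φ x ^ 2 := by
    simpa only [sq] using! hφs.mul_left (f := φ)
  have hgradu (x) : HasGradientAt u (gradient u x) x :=
    (hu.differentiable two_ne_zero x).hasGradientAt
  have hgradφ (x) : HasGradientAt φ (gradient φ x) x :=
    (hφ.differentiable two_ne_zero x).hasGradientAt
  have hgradpow (s : ℝ) (x) :
      HasGradientAt (fun y => u y ^ s) ((s * u x ^ (s - 1)) • gradient u x) x :=
    (Real.hasDerivAt_rpow_const (Or.inl (hune x))).comp_hasGradientAt x (hgradu x)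
  have hstab := hstable (fun x => u x ^ (-p) * φ x) ((hpow _).mul hφ) hφs.mul_left
  have hgψ (x) : gradient (fun y => u y ^ (-p) * φ y) x =
      u x ^ (-p) • gradient φ x - (p * u x ^ (-p - 1) * φ x) • gradient u x := by
    rw [((hgradpow (-p) x).fun_mul (hgradφ x)).gradient]
    module
  have hgg (x) : gradient (fun y => u y ^ (-2 * p - 1) * φ y ^ 2) x =
      (2 * u x ^ (-2 * p - 1) * φ x) • gradient φ x -
        ((2 * p + 1) * u x ^ (-2 * p - 2) * φ x ^ 2) • gradient u x := by
    simp only [sq (φ _)]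
    rw [((hgradpow (-2 * p - 1) x).fun_mul ((hgradφ x).fun_mul (hgradφ x))).gradient,
      show -2 * p - 1 - 1 = -2 * p - 2 by ring]
    module
  have hdiv := integral_mul_vdiv hV (((hpow (-2 * p - 1)).mul (hφ.pow 2)).of_le one_le_two)
    hφ2s.mul_left
  have hdivc := continuous_vdiv hV
  have hpow₁ (x) : u x ^ (-3 * p - 1) = u x ^ (-p - 1) * (u x ^ (-p)) ^ 2 := by
    rw [sq, ← rpow_add (hupos x), ← rpow_add (hupos x)]; ring_nf
  have hpow₂ (x) : u x ^ (-2 * p - 1) = u x ^ (-p - 1) * u x ^ (-p) := by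
    rw [← rpow_add (hupos x)]; ring_nf
  have hpow₃ (x) : u x ^ (-2 * p - 2) = (u x ^ (-p - 1)) ^ 2 := by
    rw [sq, ← rpow_add (hupos x)]; ring_nf
  have hpow₄ (x) : u x ^ (-2 * p) = (u x ^ (-p)) ^ 2 := by
    rw [sq, ← rpow_add (hupos x)]; ring_nf
  have hiE : Integrable fun x => ω₂ x * u x ^ (-3 * p - 1) * φ x ^ 2 :=
    Continuous.integrable_of_hasCompactSupport (by fun_prop) hφ2s.mul_left
  have hiY : Integrable fun x => ω₁ x * u x ^ (-2 * p) * ‖gradient φ x‖ ^ 2 :=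
    Continuous.integrable_of_hasCompactSupport (by fun_prop)
      (hφs.gradient.comp_left (g := fun v => ‖v‖ ^ 2) (by simp)).mul_left
  have hiψ : Integrable fun x => ω₁ x * ‖gradient (fun y => u y ^ (-p) * φ y) x‖ ^ 2 := by
    have hs : HasCompactSupport fun y => u y ^ (-p) * φ y := hφs.mul_left
    refine Continuous.integrable_of_hasCompactSupport ?_
      (hs.gradient.comp_left (g := fun v => ‖v‖ ^ 2) (by simp)).mul_left
    simp only [hgψ]
    fun_prop
  have hiV : Integrable fun x => ⟪ω₁ x • gradient u x,
      gradient (fun y => u y ^ (-2 * p - 1) * φ y ^ 2) x⟫ := by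
    have hs : HasCompactSupport fun y => u y ^ (-2 * p - 1) * φ y ^ 2 := hφ2s.mul_left
    refine Continuous.integrable_of_hasCompactSupport ?_ (hs.gradient.mono fun x hx h => hx ?_)
    · simp only [hgg]
      fun_prop
    · simp only [h, inner_zero_right]
  have hle : ∫ x, u x ^ (-2 * p - 1) * φ x ^ 2 * vdiv (fun y => ω₁ y • gradient u y) x ≤
      ∫ x, ω₂ x * u x ^ (-3 * p - 1) * φ x ^ 2 := by
    refine integral_mono (Continuous.integrable_of_hasCompactSupport (by fun_prop)
      (HasCompactSupport.mul_right hφ2s.mul_left)) hiE fun x => ?_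
    have h₁ := neg_le_neg_iff.1 (hsuper x)
    have h₂ : 0 ≤ u x ^ (-2 * p - 1) * φ x ^ 2 := by have := hupos x; positivity
    calc _ ≤ _ := mul_le_mul_of_nonneg_left h₁ h₂
      _ = _ := by rw [hpow₁, hpow₂]; ring
  have hE : ∫ x, p * ω₂ x * u x ^ (-p - 1) * (u x ^ (-p) * φ x) ^ 2 =
      p * ∫ x, ω₂ x * u x ^ (-3 * p - 1) * φ x ^ 2 := by
    rw [← integral_const_mul]
    congr 1 with x
    rw [hpow₁]; ring
  have hquad : ∫ x, (ω₁ x * ‖gradient (fun y => u y ^ (-p) * φ y) x‖ ^ 2 +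
      p / 2 * ⟪ω₁ x • gradient u x, gradient (fun y => u y ^ (-2 * p - 1) * φ y ^ 2) x⟫) ≤
      ∫ x, (1 + p / 2) * (ω₁ x * u x ^ (-2 * p) * ‖gradient φ x‖ ^ 2) := by
    refine integral_mono (hiψ.add (hiV.const_mul _)) (hiY.const_mul _) fun x => ?_
    simp only [hgψ, hgg]
    simp only [hpow₂, hpow₃, hpow₄]
    have hexp : ω₁ x * ‖u x ^ (-p) • gradient φ x -
        (p * u x ^ (-p - 1) * φ x) • gradient u x‖ ^ 2 +
        p / 2 * ⟪ω₁ x • gradient u x, (2 * (u x ^ (-p - 1) * u x ^ (-p)) * φ x) • gradient φ x -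
          ((2 * p + 1) * (u x ^ (-p - 1)) ^ 2 * φ x ^ 2) • gradient u x⟫ =
        (1 + p / 2) * (ω₁ x * (u x ^ (-p)) ^ 2 * ‖gradient φ x‖ ^ 2) -
          p / 2 * ω₁ x * ‖(u x ^ (-p - 1) * φ x) • gradient u x + u x ^ (-p) • gradient φ x‖ ^ 2 := by
      rw [norm_sub_sq_real, norm_add_sq_real]
      simp only [norm_smul, inner_sub_right, real_inner_smul_left, real_inner_smul_right,
        real_inner_self_eq_norm_sq, mul_pow, Real.norm_eq_abs, sq_abs]
      rw [real_inner_comm (gradient u x) (gradient φ x)]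
      ring
    have hpos : 0 ≤ p / 2 * ω₁ x * ‖(u x ^ (-p - 1) * φ x) • gradient u x +
        u x ^ (-p) • gradient φ x‖ ^ 2 := by
      have := hω₁pos x
      positivity
    linarith
  rw [integral_add hiψ (hiV.const_mul _), integral_const_mul, integral_const_mul] at hquad
  rw [hE] at hstab
  rw [hdiv] at hle
  have := mul_le_mul_of_nonneg_left hle (half_pos hp).le
  linarith

theorem exists_weighted_young {p A : ℝ} (hp : 0 < p) (hA : 0 ≤ A) :
    ∃ B : ℝ, 0 ≤ B ∧ ∀ a t D : ℝ, 0 < a → 0 ≤ t → t ≤ 1 → 0 ≤ D →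
      A * a ^ (-2 * p) * t ^ 4 * D ^ 2 ≤
        p / 2 * a ^ (-3 * p - 1) * t ^ 6 + B * D ^ (2 * ((3 * p + 1) / (p + 1))) := by
  set P := (3 * p + 1) / (2 * p) with hP
  set Q := (3 * p + 1) / (p + 1) with hQ
  have hPpos : 0 < P := by positivity
  have hP1 : 1 < P := by rw [hP, one_lt_div (by positivity)]; linarith
  have hQ1 : 1 < Q := by rw [hQ, one_lt_div (by positivity)]; linarith
  have hPQ : P.HolderConjugate Q := by
    rw [holderConjugate_iff]
    refine ⟨hP1, ?_⟩
    rw [hP, hQ]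
    field_simp
    ring
  set δ := (p / 2) ^ P⁻¹ with hδ
  have hδpos : 0 < δ := by positivity
  refine ⟨(A / δ) ^ Q, by positivity, fun a t D ha ht ht1 hD => ?_⟩
  have hx : 0 ≤ δ * a ^ (-2 * p) * t ^ 4 := by positivity
  have hy : 0 ≤ A / δ * D ^ 2 := by positivity
  have hxP : (δ * a ^ (-2 * p) * t ^ 4) ^ P ≤ p / 2 * a ^ (-3 * p - 1) * t ^ 6 := by
    rw [mul_rpow (by positivity) (by positivity), mul_rpow (by positivity) (by positivity), hδ,
      rpow_inv_rpow (by positivity) hPpos.ne', ← rpow_mul ha.le,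
      show -2 * p * P = -3 * p - 1 by rw [hP]; field_simp; ring]
    gcongr
    rw [← rpow_natCast t 4, ← rpow_natCast t 6, ← rpow_mul ht]
    refine rpow_le_rpow_of_exponent_ge' ht ht1 (by norm_num) ?_
    rw [hP]
    push_cast
    field_simp
    linarith
  have hyQ : (A / δ * D ^ 2) ^ Q = (A / δ) ^ Q * D ^ (2 * Q) := by
    rw [mul_rpow (by positivity) (by positivity), ← rpow_natCast D 2, ← rpow_mul hD]
    norm_num
  calc A * a ^ (-2 * p) * t ^ 4 * D ^ 2
      = (δ * a ^ (-2 * p) * t ^ 4) * (A / δ * D ^ 2) := by field_simp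
    _ ≤ (δ * a ^ (-2 * p) * t ^ 4) ^ P / P + (A / δ * D ^ 2) ^ Q / Q :=
        young_inequality_of_nonneg hx hy hPQ
    _ ≤ (δ * a ^ (-2 * p) * t ^ 4) ^ P + (A / δ * D ^ 2) ^ Q :=
        add_le_add (div_le_self (by positivity) hP1.le) (div_le_self (by positivity) hQ1.le)
    _ ≤ _ := by rw [hyQ]; gcongr

theorem lt_of_lt_one_add_mul_add_sqrt {N p : ℝ} (hp : 0 < p)
    (hdim : N < 1 + 2 / (p + 1) * (p + √(p * (p + 1)))) :
    N < 2 * ((3 * p + 1) / (p + 1)) := by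
  refine hdim.trans ?_
  have h : √(p * (p + 1)) ≤ p + 1 / 2 := by
    rw [sqrt_le_left (by positivity)]
    nlinarith
  have h₁ : 2 / (p + 1) * (p + √(p * (p + 1))) ≤ 2 / (p + 1) * (2 * p + 1 / 2) :=
    mul_le_mul_of_nonneg_left (by linarith) (by positivity)
  have h₂ : 1 + 2 / (p + 1) * (2 * p + 1 / 2) < 2 * ((3 * p + 1) / (p + 1)) := by
    field_simp
    linarith
  linarith

theorem stmt_14 (N : ℕ) (hN : 1 ≤ N) (p : ℝ) (hp : 0 < p)
    (hdim : (N : ℝ) < 1 + 2/(p + 1) * (p + Real.sqrt (p * (p + 1))))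
    (ω₁ ω₂ : EuclideanSpace ℝ (Fin N) → ℝ)
    (hω₁ : ContDiff ℝ (⊤ : ℕ∞) ω₁) (hω₂ : ContDiff ℝ (⊤ : ℕ∞) ω₂)
    (hω₁pos : ∀ x, 0 < ω₁ x) (hω₂pos : ∀ x, 0 < ω₂ x)
    (hbdd : ∃ M : ℝ, ∀ x, ω₂ x ≤ M)
    (hcomp : ∃ C : ℝ, 0 < C ∧ ∃ R₀ : ℝ, ∀ x : EuclideanSpace ℝ (Fin N), R₀ ≤ ‖x‖ →
      ω₁ x ≤ C * ω₂ x ∧ ‖gradient ω₁ x‖ ≤ C * ω₂ x) :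
    ¬ ∃ u : EuclideanSpace ℝ (Fin N) → ℝ, ContDiff ℝ 2 u ∧ (∀ x, 0 < u x) ∧
      (∀ x, -(ω₂ x * u x ^ (-p)) ≤ -vdiv (fun y => ω₁ y • gradient u y) x) ∧
      (∀ ψ : EuclideanSpace ℝ (Fin N) → ℝ, ContDiff ℝ 2 ψ → HasCompactSupport ψ →
        ∫ x, p * ω₂ x * u x ^ (-p - 1) * ψ x ^ 2 ≤ ∫ x, ω₁ x * ‖gradient ψ x‖ ^ 2) := by
  rintro ⟨u, hu, hupos, hsuper, hstable⟩
  obtain ⟨M, hM⟩ := hbdd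
  obtain ⟨C, hC, R₀, hR₀⟩ := hcomp
  obtain ⟨K, hK, hcut⟩ := exists_cutoff N
  obtain ⟨B, hB, hyoung⟩ := exists_weighted_young (A := (2 + p) * 9 * C) hp (by positivity)
  have hNQ := lt_of_lt_one_add_mul_add_sqrt hp hdim
  set Q := (3 * p + 1) / (p + 1)
  have hQpos : 0 < Q := by positivity
  have hMpos : 0 < M := (hω₂pos 0).trans_le (hM 0)
  have hω₁c := hω₁.continuous
  have hω₂c := hω₂.continuous
  have hupow (s : ℝ) : Continuous fun x => u x ^ s :=
    hu.continuous.rpow_const fun x => Or.inl (hupos x).ne'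
  have hiE {η : EuclideanSpace ℝ (Fin N) → ℝ} (hη : Continuous η) (hηs : HasCompactSupport η) :
      Continuous (fun x => ω₂ x * u x ^ (-3 * p - 1) * (η x ^ 3) ^ 2) ∧
      HasCompactSupport (fun x => ω₂ x * u x ^ (-3 * p - 1) * (η x ^ 3) ^ 2) :=
    ⟨by fun_prop, (hηs.comp_left (g := fun t => (t ^ 3) ^ 2) (by simp)).mul_left⟩
  obtain ⟨η₁, hη₁, hη₁s, hη₁0, hη₁1, hη₁one, hη₁zero, -, -⟩ := hcut 1 one_pos
  set c := ∫ x, ω₂ x * u x ^ (-3 * p - 1) * (η₁ x ^ 3) ^ 2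
  have hc : 0 < c := by
    refine (hiE hη₁.continuous hη₁s).1.integral_pos_of_hasCompactSupport_nonneg_nonzero
      (x := 0) (hiE hη₁.continuous hη₁s).2 (fun x => ?_) ?_
    · have := hω₂pos x
      have := hupos x
      positivity
    · have := hω₂pos 0
      have := rpow_pos_of_pos (hupos 0) (-3 * p - 1)
      rw [hη₁one 0 (by simp)]
      positivity
  set v := volume.real (Metric.closedBall (0 : EuclideanSpace ℝ (Fin N)) 1)
  have key (R : ℝ) (hR : max R₀ 2 ≤ R) :
      p / 2 * c ≤ B * M * K ^ (2 * Q) * 2 ^ N * v * R ^ (-(2 * Q - N)) := by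
    have hRR₀ : R₀ ≤ R := (le_max_left _ _).trans hR
    have hR2 : 2 ≤ R := (le_max_right _ _).trans hR
    have hRpos : 0 < R := two_pos.trans_le hR2
    obtain ⟨η, hη, hηs, hη0, hη1, hηone, -, hηK, hηzero⟩ := hcut R hRpos
    have hcE : c ≤ ∫ x, ω₂ x * u x ^ (-3 * p - 1) * (η x ^ 3) ^ 2 := by
      refine integral_mono
        ((hiE hη₁.continuous hη₁s).1.integrable_of_hasCompactSupport (hiE hη₁.continuous hη₁s).2)
        ((hiE hη.continuous hηs).1.integrable_of_hasCompactSupport (hiE hη.continuous hηs).2)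
        fun x => ?_
      have := hω₂pos x
      have := hupos x
      have h₀ := hη₁0 x
      have hle : η₁ x ≤ η x := by
        rcases le_total ‖x‖ R with hx | hx
        · exact (hη₁1 x).trans (hηone x hx).ge
        · exact (hη₁zero x (by linarith)).le.trans (hη0 x)
      dsimp only
      gcongr
    have hcacc := stable_caccioppoli hp (hω₁.of_le (by exact_mod_cast le_top)) hω₂c hω₁pos hu hupos
      hsuper hstable (hη.pow 3) (hηs.comp_left (g := fun t => t ^ 3) (by simp))
    have hgrad (x) : gradient (fun y => η y ^ 3) x = (3 * η x ^ 2) • gradient η x := by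
      have h := (hasDerivAt_pow 3 (η x)).comp_hasGradientAt x
        (hη.differentiable two_ne_zero x).hasGradientAt
      simpa using h.gradient
    set S := Metric.closedBall (0 : EuclideanSpace ℝ (Fin N)) (2 * R)
    set b := B * M * (K / R) ^ (2 * Q)
    have hb : 0 ≤ b := by positivity
    have hSfin : volume S ≠ ⊤ := measure_closedBall_lt_top.ne
    have hiS : Integrable (S.indicator fun _ => b) :=
      (integrable_indicator_iff measurableSet_closedBall).2 (integrableOn_const hSfin)
    have hptw (x) : (2 + p) * (ω₁ x * u x ^ (-2 * p) * ‖gradient (fun y => η y ^ 3) x‖ ^ 2) ≤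
        p / 2 * (ω₂ x * u x ^ (-3 * p - 1) * (η x ^ 3) ^ 2) + S.indicator (fun _ => b) x := by
      have h₂ := hω₂pos x
      have hux := hupos x
      have hind : 0 ≤ S.indicator (fun _ => b) x := Set.indicator_nonneg (fun _ _ => hb) x
      by_cases hx : ‖x‖ < R ∨ 2 * R < ‖x‖
      · rw [hgrad, hηzero x hx, smul_zero, norm_zero]
        have : 0 ≤ p / 2 * (ω₂ x * u x ^ (-3 * p - 1) * (η x ^ 3) ^ 2) := by positivity
        linarith
      · push Not at hx
        rw [hgrad, norm_smul, Set.indicator_of_mem (by simpa [S] using hx.2)]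
        have hD := hηK x
        have hDQ : ‖gradient η x‖ ^ (2 * Q) ≤ (K / R) ^ (2 * Q) := by gcongr
        calc (2 + p) * (ω₁ x * u x ^ (-2 * p) * (‖3 * η x ^ 2‖ * ‖gradient η x‖) ^ 2)
            ≤ (2 + p) * ((C * ω₂ x) * u x ^ (-2 * p) * (‖3 * η x ^ 2‖ * ‖gradient η x‖) ^ 2) := by
              gcongr
              exact (hR₀ x (hRR₀.trans hx.1)).1
          _ = ω₂ x * ((2 + p) * 9 * C * u x ^ (-2 * p) * η x ^ 4 * ‖gradient η x‖ ^ 2) := by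
              rw [mul_pow, Real.norm_eq_abs, sq_abs]
              ring
          _ ≤ ω₂ x * (p / 2 * u x ^ (-3 * p - 1) * η x ^ 6 + B * ‖gradient η x‖ ^ (2 * Q)) := by
              gcongr
              exact hyoung _ _ _ hux (hη0 x) (hη1 x) (norm_nonneg _)
          _ = p / 2 * (ω₂ x * u x ^ (-3 * p - 1) * (η x ^ 3) ^ 2) +
              B * ω₂ x * ‖gradient η x‖ ^ (2 * Q) := by ring
          _ ≤ _ := by
              dsimp only [b]
              gcongr
              exact hM x
    have hiη :=
      (hiE hη.continuous hηs).1.integrable_of_hasCompactSupport (μ := volume)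
        (hiE hη.continuous hηs).2
    have hint := integral_mono_of_nonneg (μ := volume) (Eventually.of_forall fun x => ?_)
      ((hiη.const_mul (p / 2)).add hiS) (Eventually.of_forall hptw)
    · simp only [Pi.add_apply] at hint
      rw [integral_const_mul, integral_add (hiη.const_mul _) hiS, integral_const_mul,
        integral_indicator_const _ measurableSet_closedBall,
        Measure.addHaar_real_closedBall' _ _ (by positivity), finrank_euclideanSpace_fin,
        smul_eq_mul] at hint
      have hbR : (2 * R) ^ N * v * b =
          B * M * K ^ (2 * Q) * 2 ^ N * v * R ^ (-(2 * Q - N)) := by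
        rw [neg_sub, rpow_sub hRpos, rpow_natCast]
        simp only [b]
        rw [div_rpow hK hRpos.le, mul_pow]
        ring
      rw [← hbR]
      have := mul_le_mul_of_nonneg_left hcE (half_pos hp).le
      linarith
    · have := hω₁pos x
      have := hupos x
      simp only [Pi.zero_apply]
      positivity
  have hlim := (tendsto_rpow_neg_atTop (sub_pos.2 hNQ)).const_mul
    (B * M * K ^ (2 * Q) * 2 ^ N * v)
  rw [mul_zero] at hlim
  have := ge_of_tendsto hlim ((eventually_ge_atTop _).mono key)
  have : 0 < p / 2 * c := by positivity
  linarith
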